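/- arXiv:1007.5412 — 2 statements merged into one kernel-verified Lean document; each statement's English description precedes it below -/
import Mathlib

section
/- Let m, p be positive integers with p ≥ 3, and let (a_n)_{n∈ℤ}, (b_n)_{n∈ℤ} be p-periodic sequences of complex m×m matrices with b_n Hermitian. Let J be the operator on ℓ²(ℤ, ℂ^m) given by (Jy)_n = a_n y_{n+1} + b_n y_n + a_{n-1}* y_{n-1}. For x ∈ [0, 2π] let K(x) be the pm×pm Hermitian block matrix with diagonal blocks b_1, …, b_p, superdiagonal blocks a_1, …, a_{p-1} (and their adjoints on the subdiagonal), top-right corner block e^{-ix} a_0* and bottom-left corner block e^{ix} a_0, where a_0 = a_p, and all other blocks zero. Then σ(J) = ⋃_{x ∈ [0, 2π]} σ(K(x)). -/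
open ComplexOrder Matrix
open scoped ENNReal

/-- The Floquet matrix `K(x)`: the `pm × pm` Hermitian block matrix with diagonal blocks
`b_1, …, b_p`, superdiagonal blocks `a_1, …, a_{p-1}` (their adjoints on the subdiagonal),
top-right corner block `e^{-ix} a_0*` and bottom-left corner block `e^{ix} a_0`. -/
noncomputable def FloquetK (m p : ℕ) (a b : ℤ → Matrix (Fin m) (Fin m) ℂ) (x : ℝ) :
    Matrix (Fin p × Fin m) (Fin p × Fin m) ℂ :=
  fun q r =>
    if q.1 = r.1 then b ((q.1 : ℕ) + 1) q.2 r.2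
    else if (q.1 : ℕ) + 1 = (r.1 : ℕ) then a ((q.1 : ℕ) + 1) q.2 r.2
    else if (r.1 : ℕ) + 1 = (q.1 : ℕ) then (a ((r.1 : ℕ) + 1))ᴴ q.2 r.2
    else if (q.1 : ℕ) = 0 ∧ (r.1 : ℕ) = p - 1 then
      Complex.exp (-(x : ℂ) * Complex.I) * (a 0)ᴴ q.2 r.2
    else if (q.1 : ℕ) = p - 1 ∧ (r.1 : ℕ) = 0 then
      Complex.exp ((x : ℂ) * Complex.I) * a 0 q.2 r.2
    else 0

/-- The Jacobi difference expression `a_n Y_{n+1} + b_n Y_n + a_{n-1}* Y_{n-1}` on arbitrary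
vector-valued sequences. -/
noncomputable def jacobiExpr {m : ℕ} (a b : ℤ → Matrix (Fin m) (Fin m) ℂ) (Y : ℤ → Fin m → ℂ)
    (n : ℤ) : Fin m → ℂ :=
  a n *ᵥ Y (n + 1) + b n *ᵥ Y n + (a (n - 1))ᴴ *ᵥ Y (n - 1)

theorem mulVec_apply_of_three_blocks {m p : ℕ} {M : Matrix (Fin p × Fin m) (Fin p × Fin m) ℂ}
    {q s t : Fin p} {A B C : Matrix (Fin m) (Fin m) ℂ} {i : Fin m}
    (hM : ∀ r j, M (q, i) (r, j) = (if r = s then A i j else 0) + (if r = q then B i j else 0) +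
      (if r = t then C i j else 0)) (v : Fin p × Fin m → ℂ) :
    (M *ᵥ v) (q, i) = (A *ᵥ fun j => v (s, j)) i + (B *ᵥ fun j => v (q, j)) i +
      (C *ᵥ fun j => v (t, j)) i := by
  simp only [Matrix.mulVec, dotProduct, Fintype.sum_prod_type, hM, add_mul, ite_mul, zero_mul,
    Finset.sum_add_distrib]
  congr 1
  · congr 1 <;> (rw [Finset.sum_comm]; simp)
  · rw [Finset.sum_comm]; simp

/-- On Bloch sequences the Floquet matrix acts as the Jacobi difference expression. -/
theorem floquetK_mulVec_of_bloch {m p : ℕ} (hp : 3 ≤ p) {a b : ℤ → Matrix (Fin m) (Fin m) ℂ}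
    (hper : ∀ n : ℤ, a (n + p) = a n ∧ b (n + p) = b n) {x : ℝ} {Y : ℤ → Fin m → ℂ}
    (hY : ∀ n, Y (n + p) = Complex.exp (x * Complex.I) • Y n) :
    FloquetK m p a b x *ᵥ (fun q => Y ((q.1 : ℕ) + 1) q.2) =
      fun q => jacobiExpr a b Y ((q.1 : ℕ) + 1) q.2 := by
  have hap : a p = a 0 := by simpa using (hper 0).1
  have h1 : Y (p + 1) = Complex.exp (x * Complex.I) • Y 1 := by rw [add_comm, hY]
  have h0 : Y 0 = Complex.exp (-(x : ℂ) * Complex.I) • Y p := by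
    have := hY 0
    rw [zero_add] at this
    rw [this, smul_smul, ← Complex.exp_add]
    simp
  ext ⟨⟨q, hq⟩, i⟩
  simp only [jacobiExpr, Pi.add_apply]
  rcases Nat.eq_zero_or_pos q with rfl | hq0
  · rw [mulVec_apply_of_three_blocks (s := ⟨1, by omega⟩) (t := ⟨p - 1, by omega⟩) (A := a 1)
      (B := b 1) (C := Complex.exp (-(x : ℂ) * Complex.I) • (a 0)ᴴ)]
    · have : ((p - 1 : ℕ) : ℤ) + 1 = p := by omega
      simp [h0, this, Matrix.smul_mulVec, Matrix.mulVec_smul]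
    · rintro ⟨r, hr⟩ j
      simp only [FloquetK, Fin.mk.injEq]
      rcases Nat.eq_zero_or_pos r with rfl | hr0
      · have e1 : ¬ (0 = p - 1) := by omega
        simp [e1]
      · by_cases h : r = 1
        · subst h
          have e1 : ¬ (1 = p - 1) := by omega
          simp [e1]
        · by_cases h' : r = p - 1
          · simp [show ¬ (0 = r) by omega, show ¬ (1 = r) by omega, h, ← h',
              show ¬ (r = 0) by omega]
          · simp [show ¬ (0 = r) by omega, show ¬ (1 = r) by omega, h, h',
              show ¬ (r = 0) by omega]
  · rcases Nat.lt_or_ge (q + 1) p with hq1 | hq1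
    · rw [mulVec_apply_of_three_blocks (s := ⟨q + 1, by omega⟩) (t := ⟨q - 1, by omega⟩)
        (A := a (q + 1)) (B := b (q + 1)) (C := (a q)ᴴ)]
      · have : ((q - 1 : ℕ) : ℤ) + 1 = q := by omega
        simp [this]
      · rintro ⟨r, hr⟩ j
        simp only [FloquetK, Fin.mk.injEq]
        by_cases h : r = q
        · subst h
          simp [show ¬ (r = r - 1) by omega]
        · by_cases h1 : r = q + 1
          · subst h1
            simp [show ¬ (q + 1 = q - 1) by omega]
          · by_cases h2 : r + 1 = q
            · subst h2
              simp [show ¬ (r = r + 1 + 1) by omega, show ¬ (r + 1 + 1 = r) by omega]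
            · simp [h, h1, h2, Ne.symm h, Ne.symm h1, show ¬ (r = q - 1) by omega,
                show ¬ (q = 0) by omega, show ¬ (q = p - 1) by omega]
    · obtain rfl : p = q + 1 := by omega
      rw [mulVec_apply_of_three_blocks (s := ⟨0, by omega⟩) (t := ⟨q - 1, by omega⟩)
        (A := Complex.exp ((x : ℂ) * Complex.I) • a 0) (B := b (q + 1)) (C := (a q)ᴴ)]
      · have : ((q - 1 : ℕ) : ℤ) + 1 = q := by omega
        push_cast at h1 hap
        simp [this, h1, hap, Matrix.smul_mulVec, Matrix.mulVec_smul]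
      · rintro ⟨r, hr⟩ j
        simp only [FloquetK, Fin.mk.injEq]
        by_cases h : r = q
        · subst h
          simp [show ¬ (r = r - 1) by omega, show ¬ (r = 0) by omega]
        · by_cases h2 : r + 1 = q
          · subst h2
            simp [show ¬ (r + 1 + 1 = r) by omega, show ¬ (r = 0) by omega]
          · by_cases h3 : r = 0
            · subst h3
              simp [show ¬ (q = 0) by omega, show ¬ (0 + 1 = q) by omega,
                show ¬ (0 = q) by omega, show ¬ (0 = q - 1) by omega]
            · simp [h, h2, h3, Ne.symm h, show ¬ (r = q - 1) by omega,
                show ¬ (q = 0) by omega, show ¬ (q + 1 = r) by omega]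

theorem jacobiExpr_add_period {m p : ℕ} {a b : ℤ → Matrix (Fin m) (Fin m) ℂ}
    (hper : ∀ n : ℤ, a (n + p) = a n ∧ b (n + p) = b n) {c : ℂ} {Y : ℤ → Fin m → ℂ}
    (hY : ∀ n, Y (n + p) = c • Y n) (n : ℤ) :
    jacobiExpr a b Y (n + p) = c • jacobiExpr a b Y n := by
  have h1 : (n + p - 1 : ℤ) = n - 1 + p := by ring
  simp only [jacobiExpr, h1, (hper _).1, (hper _).2, hY, add_right_comm n (p : ℤ) 1,
    Matrix.mulVec_smul, smul_add]

/-- The Floquet–Bloch transform of a sequence at quasi-momentum `x`. -/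
noncomputable def blochTransform {m : ℕ} (p : ℕ) (x : ℝ) (Y : ℤ → Fin m → ℂ) (n : ℤ) :
    Fin m → ℂ :=
  fun i => ∑' l : ℤ, Complex.exp (-(l * x) * Complex.I) * Y (n + l * p) i

theorem blochTransform_add_period {m : ℕ} (p : ℕ) (x : ℝ) (Y : ℤ → Fin m → ℂ) (n : ℤ) :
    blochTransform p x Y (n + p) = Complex.exp (x * Complex.I) • blochTransform p x Y n := by
  ext i
  simp only [blochTransform, Pi.smul_apply, smul_eq_mul]
  rw [← tsum_mul_left, ← (Equiv.addRight (1 : ℤ)).tsum_eq]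
  conv_rhs => rw [← (Equiv.addRight (1 : ℤ)).tsum_eq]
  rw [← (Equiv.subRight (1 : ℤ)).tsum_eq]
  refine tsum_congr fun l => ?_
  simp only [Equiv.subRight_apply, Equiv.coe_addRight, sub_add_cancel, ← mul_assoc,
    ← Complex.exp_add]
  congr 2
  · push_cast; ring
  · ring_nf

theorem finite_support_comp_progression {E : Type*} [Zero E] {p : ℕ} (hp : 0 < p) {Y : ℤ → E}
    (hY : Y.support.Finite) (n : ℤ) : (fun l : ℤ => Y (n + l * p)).support.Finite := by
  refine (hY.preimage (f := fun l : ℤ => n + l * p) ?_).subset fun l hl => hl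
  intro l _ l' _ h
  simpa [hp.ne'] using h

theorem summable_blochTransform {m p : ℕ} (hp : 0 < p) (x : ℝ) {Y : ℤ → Fin m → ℂ}
    (hY : Y.support.Finite) (n : ℤ) (i : Fin m) :
    Summable fun l : ℤ => Complex.exp (-(l * x) * Complex.I) * Y (n + l * p) i := by
  refine summable_of_hasFiniteSupport ((finite_support_comp_progression hp hY n).subset ?_)
  intro l hl h
  exact hl (by simp [show Y (n + l * p) = 0 from h])

theorem mulVec_blochTransform {m p : ℕ} (hp : 0 < p) (x : ℝ) {Y : ℤ → Fin m → ℂ}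
    (hY : Y.support.Finite) {A : ℤ → Matrix (Fin m) (Fin m) ℂ} (n k : ℤ)
    (hA : ∀ l : ℤ, A (n + l * p) = A n) (i : Fin m) :
    HasSum (fun l : ℤ => Complex.exp (-(l * x) * Complex.I) *
      (A (n + l * p) *ᵥ Y (n + k + l * p)) i) ((A n *ᵥ blochTransform p x Y (n + k)) i) := by
  simp only [hA, Matrix.mulVec, dotProduct, blochTransform, Finset.mul_sum]
  refine hasSum_sum fun j _ => ?_
  simpa only [mul_left_comm] using
    (summable_blochTransform hp x hY (n + k) j).hasSum.mul_left (A n i j)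

theorem blochTransform_jacobiExpr {m p : ℕ} (hp : 0 < p) {a b : ℤ → Matrix (Fin m) (Fin m) ℂ}
    (hper : ∀ n : ℤ, a (n + p) = a n ∧ b (n + p) = b n) (x : ℝ) {Y : ℤ → Fin m → ℂ}
    (hY : Y.support.Finite) :
    blochTransform p x (jacobiExpr a b Y) = jacobiExpr a b (blochTransform p x Y) := by
  have ha : Function.Periodic a p := fun n => (hper n).1
  have hb : Function.Periodic b p := fun n => (hper n).2
  ext n i
  refine HasSum.tsum_eq ?_
  have h := ((mulVec_blochTransform hp x hY n 1 (fun l => ha.int_mul l n) i).add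
    (mulVec_blochTransform hp x hY n 0 (fun l => hb.int_mul l n) i)).add
    (mulVec_blochTransform (A := fun n => (a (n - 1))ᴴ) hp x hY n (-1)
      (fun l => by rw [add_sub_right_comm]; exact congrArg _ (ha.int_mul l (n - 1))) i)
  simpa only [jacobiExpr, Pi.add_apply, mul_add, add_zero, ← sub_eq_add_neg, add_right_comm n,
    add_sub_right_comm] using h

theorem blochTransform_sub_smul {m p : ℕ} (hp : 0 < p) (x : ℝ) {Y Z : ℤ → Fin m → ℂ}
    (hY : Y.support.Finite) (hZ : Z.support.Finite) (z : ℂ) :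
    blochTransform p x (Z - z • Y) = blochTransform p x Z - z • blochTransform p x Y := by
  ext n i
  refine HasSum.tsum_eq ?_
  have h := (summable_blochTransform hp x hZ n i).hasSum.sub
    ((summable_blochTransform hp x hY n i).hasSum.mul_left z)
  simpa only [mul_left_comm z, ← mul_sub, Pi.sub_apply, Pi.smul_apply, smul_eq_mul,
    blochTransform] using h

theorem finite_support_jacobiExpr {m : ℕ} (a b : ℤ → Matrix (Fin m) (Fin m) ℂ)
    {Y : ℤ → Fin m → ℂ} (hY : Y.support.Finite) : (jacobiExpr a b Y).support.Finite := by
  refine (((hY.preimage (f := fun n => n + 1) (by simp)).union hY).union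
    (hY.preimage (f := fun n => n - 1) (by simp))).subset fun n hn => ?_
  by_contra h
  simp only [Set.mem_union, Set.mem_preimage, Function.mem_support, not_or, not_not] at h
  exact hn (by simp [jacobiExpr, h])

/-- Parseval's identity for trigonometric polynomials. -/
theorem integral_norm_sq_tsum_exp {g : ℤ → ℂ} (hg : g.support.Finite) :
    Continuous (fun x : ℝ => ‖∑' l : ℤ, Complex.exp (-(l * x) * Complex.I) * g l‖ ^ 2) ∧
    ∫ x in (0 : ℝ)..(2 * Real.pi), ‖∑' l : ℤ, Complex.exp (-(l * x) * Complex.I) * g l‖ ^ 2 =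
      2 * Real.pi * ∑' l, ‖g l‖ ^ 2 := by
  set S := hg.toFinset
  have hS : ∀ l ∉ S, g l = 0 := fun l hl => by simpa [S] using hl
  have hsum : ∀ x : ℝ, ∑' l : ℤ, Complex.exp (-(l * x) * Complex.I) * g l =
      ∑ l ∈ S, Complex.exp (-(l * x) * Complex.I) * g l := fun x =>
    tsum_eq_sum fun l hl => by simp [hS l hl]
  simp only [hsum]
  refine ⟨by fun_prop, ?_⟩
  rw [tsum_eq_sum (s := S) fun l hl => by simp [hS l hl]]
  have hexp : ∀ x : ℝ, ((‖∑ l ∈ S, Complex.exp (-(l * x) * Complex.I) * g l‖ ^ 2 : ℝ) : ℂ) =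
      ∑ k ∈ S, ∑ l ∈ S, (g k * (starRingEnd ℂ) (g l)) *
        Complex.exp ((((l - k : ℤ) : ℂ) * Complex.I) * x) := by
    intro x
    push_cast
    rw [← Complex.mul_conj', map_sum, Finset.sum_mul_sum]
    refine Finset.sum_congr rfl fun k _ => Finset.sum_congr rfl fun l _ => ?_
    have : ((l - k : ℂ) * Complex.I) * x = -(k * x) * Complex.I + (l * x) * Complex.I := by ring
    rw [map_mul, ← Complex.exp_conj, this, Complex.exp_add]
    simp only [map_mul, map_neg, Complex.conj_ofReal, Complex.conj_I, map_intCast]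
    ring_nf
  have hexp_integral : ∀ n : ℤ,
      ∫ x in (0 : ℝ)..(2 * Real.pi), Complex.exp (((n : ℂ) * Complex.I) * x) =
        if n = 0 then 2 * (Real.pi : ℂ) else 0 := by
    intro n
    split_ifs with h
    · simp [h]
    · have hc : (n : ℂ) * Complex.I ≠ 0 := by simp [h]
      rw [integral_exp_mul_complex hc]
      have : (n : ℂ) * Complex.I * ((2 * Real.pi : ℝ) : ℂ) = n * (2 * Real.pi * Complex.I) := by
        push_cast; ring
      rw [this, Complex.exp_int_mul_two_pi_mul_I]
      simp
  apply Complex.ofReal_injective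
  rw [← intervalIntegral.integral_ofReal]
  simp only [hexp]
  rw [intervalIntegral.integral_finsetSum fun k _ =>
    (Continuous.intervalIntegrable (by fun_prop) _ _)]
  rw [Finset.mul_sum, Complex.ofReal_sum]
  refine Finset.sum_congr rfl fun k hk => ?_
  rw [intervalIntegral.integral_finsetSum fun k _ =>
    (Continuous.intervalIntegrable (by fun_prop) _ _)]
  simp only [intervalIntegral.integral_const_mul, hexp_integral, sub_eq_zero]
  simp only [mul_ite, mul_zero, Finset.sum_ite_eq', hk, if_true, Complex.mul_conj']
  push_cast
  ring

/-- Plancherel's identity for the Floquet–Bloch transform of a finitely supported sequence. -/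
theorem integral_norm_sq_blochTransform {m p : ℕ} (hp : 0 < p) {Y : ℤ → Fin m → ℂ}
    (hY : Y.support.Finite) :
    Continuous (fun x : ℝ =>
      ∑ q : Fin p × Fin m, ‖blochTransform p x Y ((q.1 : ℕ) + 1) q.2‖ ^ 2) ∧
    ∫ x in (0 : ℝ)..(2 * Real.pi),
      ∑ q : Fin p × Fin m, ‖blochTransform p x Y ((q.1 : ℕ) + 1) q.2‖ ^ 2 =
      2 * Real.pi * ∑' n, ∑ i, ‖Y n i‖ ^ 2 := by
  have hfin : ∀ (n : ℤ) (i : Fin m), (fun l : ℤ => Y (n + l * p) i).support.Finite := by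
    intro n i
    refine (finite_support_comp_progression hp hY n).subset fun l hl h => hl ?_
    simp [show Y (n + l * p) = 0 from h]
  have hpar := fun (q : Fin p × Fin m) => integral_norm_sq_tsum_exp (hfin ((q.1 : ℕ) + 1) q.2)
  refine ⟨continuous_finsetSum _ fun q _ => (hpar q).1, ?_⟩
  simp only [blochTransform]
  rw [intervalIntegral.integral_finsetSum fun q _ => (hpar q).1.intervalIntegrable _ _]
  rw [Finset.sum_congr rfl fun q _ => (hpar q).2, ← Finset.mul_sum]
  congr 1
  have : NeZero p := ⟨hp.ne'⟩
  set e : Fin p × ℤ ≃ ℤ :=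
    ((Equiv.prodComm (Fin p) ℤ).trans (Int.divModEquiv p).symm).trans (Equiv.addRight 1)
  have he : ∀ c, e c = (c.1 : ℕ) + 1 + c.2 * p := by
    intro c
    simp [e, Int.divModEquiv]
    ring
  have hsupp : (fun c => ∑ i, ‖Y (e c) i‖ ^ 2).support.Finite := by
    refine (hY.preimage e.injective.injOn).subset fun c hc h => hc ?_
    simp [show Y (e c) = 0 from h]
  rw [← e.tsum_eq, (summable_of_hasFiniteSupport hsupp).tsum_prod, tsum_fintype,
    Fintype.sum_prod_type]
  refine Finset.sum_congr rfl fun q _ => ?_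
  rw [← Summable.tsum_finsetSum]
  · simp only [he]
  · intro i _
    refine summable_of_hasFiniteSupport ((hfin ((q : ℕ) + 1) i).subset fun l hl h => hl ?_)
    simp [show Y ((q : ℕ) + 1 + l * p) i = 0 from h]

theorem continuous_floquetK (m p : ℕ) (a b : ℤ → Matrix (Fin m) (Fin m) ℂ) :
    Continuous (FloquetK m p a b) := by
  refine continuous_matrix fun q r => ?_
  unfold FloquetK
  split_ifs <;> fun_prop

open scoped Matrix.Norms.L2Operator in
/-- A continuous family of invertible matrices over a compact set is uniformly bounded below. -/
theorem exists_uniform_lower_bound {ι : Type*} [Fintype ι] [DecidableEq ι] {s : Set ℝ}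
    (hs : IsCompact s) {M : ℝ → Matrix ι ι ℂ} (hM : Continuous M) (hu : ∀ x ∈ s, IsUnit (M x)) :
    ∃ C : ℝ, ∀ x ∈ s, ∀ v : ι → ℂ, ∑ i, ‖v i‖ ^ 2 ≤ C * ∑ i, ‖(M x *ᵥ v) i‖ ^ 2 := by
  have hc : ContinuousOn (fun x => Ring.inverse (M x)) s := by
    intro x hx
    obtain ⟨u, hu'⟩ := hu x hx
    have h := NormedRing.inverse_continuousAt u
    rw [hu'] at h
    exact (ContinuousAt.comp (f := M) h hM.continuousAt).continuousWithinAt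
  obtain ⟨C, hC⟩ := hs.exists_bound_of_continuousOn hc
  refine ⟨(|C| + 1) ^ 2, fun x hx v => ?_⟩
  have h1 := Matrix.l2_opNorm_mulVec (Ring.inverse (M x)) (WithLp.toLp 2 (M x *ᵥ v))
  have h2 : Ring.inverse (M x) *ᵥ (M x *ᵥ v) = v := by
    rw [Matrix.mulVec_mulVec, Ring.inverse_mul_cancel _ (hu x hx), Matrix.one_mulVec]
  simp only [h2] at h1
  have h3 : ‖WithLp.toLp 2 v‖ ≤ (|C| + 1) * ‖WithLp.toLp 2 (M x *ᵥ v)‖ :=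
    h1.trans (mul_le_mul_of_nonneg_right
      ((hC x hx).trans (by linarith [le_abs_self C])) (norm_nonneg _))
  have h4 := pow_le_pow_left₀ (norm_nonneg _) h3 2
  simpa only [mul_pow, EuclideanSpace.norm_sq_eq] using h4

/-- Outside the Floquet spectra, the Jacobi expression is bounded below on finitely supported
sequences. -/
theorem exists_lower_bound_of_finite_support {m p : ℕ} (hp : 3 ≤ p)
    {a b : ℤ → Matrix (Fin m) (Fin m) ℂ}
    (hper : ∀ n : ℤ, a (n + p) = a n ∧ b (n + p) = b n) {z : ℂ}
    (hz : ∀ x ∈ Set.Icc (0 : ℝ) (2 * Real.pi), z ∉ spectrum ℂ (FloquetK m p a b x)) :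
    ∃ C : ℝ, ∀ Y : ℤ → Fin m → ℂ, Y.support.Finite →
      ∑' n, ∑ i, ‖Y n i‖ ^ 2 ≤ C * ∑' n, ∑ i, ‖(jacobiExpr a b Y - z • Y) n i‖ ^ 2 := by
  have hp0 : 0 < p := by omega
  obtain ⟨C, hC⟩ := exists_uniform_lower_bound
    (M := fun x => FloquetK m p a b x - algebraMap ℂ _ z) isCompact_Icc
    ((continuous_floquetK m p a b).sub continuous_const)
    (fun x hx => by simpa using (spectrum.notMem_iff.mp (hz x hx)).neg)
  refine ⟨C, fun Y hY => ?_⟩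
  have hJ := finite_support_jacobiExpr a b hY
  have hD : (jacobiExpr a b Y - z • Y).support.Finite := by
    refine (hJ.union hY).subset fun n hn => ?_
    by_contra h
    simp only [Set.mem_union, Function.mem_support, not_or, not_not] at h
    exact hn (by simp [h])
  obtain ⟨hcY, hiY⟩ := integral_norm_sq_blochTransform hp0 hY
  obtain ⟨hcD, hiD⟩ := integral_norm_sq_blochTransform hp0 hD
  have hpi : (0 : ℝ) < 2 * Real.pi := by positivity
  have key := intervalIntegral.integral_mono_on (μ := MeasureTheory.volume) hpi.le
    (hcY.intervalIntegrable _ _) ((hcD.const_mul C).intervalIntegrable _ _) fun x hx => by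
      refine (hC x hx fun q => blochTransform p x Y ((q.1 : ℕ) + 1) q.2).trans_eq ?_
      rw [Matrix.sub_mulVec, floquetK_mulVec_of_bloch hp hper (blochTransform_add_period p x Y),
        blochTransform_sub_smul hp0 x hY hJ, blochTransform_jacobiExpr hp0 hper x hY]
      simp [Algebra.algebraMap_eq_smul_one, Matrix.smul_mulVec]
  rw [intervalIntegral.integral_const_mul, hiY, hiD, mul_left_comm] at key
  exact le_of_mul_le_mul_left key hpi

theorem norm_sq_lp_euclidean {m : ℕ} (y : lp (fun _ : ℤ => EuclideanSpace ℂ (Fin m)) 2) :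
    ‖y‖ ^ 2 = ∑' n, ∑ i, ‖y n i‖ ^ 2 := by
  have h := lp.norm_rpow_eq_tsum (p := 2) (by norm_num) y
  simpa [EuclideanSpace.norm_sq_eq] using h

/-- A closed property of `ℓ²`-sequences holding for finitely supported ones always holds. -/
theorem lp_two_induction_finite_support {E : Type*} [NormedAddCommGroup E]
    {P : lp (fun _ : ℤ => E) 2 → Prop} (hP : IsClosed {y | P y})
    (h : ∀ y : lp (fun _ : ℤ => E) 2, (Function.support fun n => y n).Finite → P y)
    (y : lp (fun _ : ℤ => E) 2) : P y := by
  refine hP.mem_of_tendsto (lp.hasSum_single (by norm_num) y) (Filter.Eventually.of_forall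
    fun s => h _ (s.finite_toSet.subset fun n hn => ?_))
  by_contra hns
  refine hn ?_
  simp only [lp.coeFn_sum, Finset.sum_apply]
  refine Finset.sum_eq_zero fun k hk => lp.single_apply_ne _ _ _ ?_
  rintro rfl
  exact hns hk

section JacobiOperator

variable {m : ℕ} {a b : ℤ → Matrix (Fin m) (Fin m) ℂ}
  {J : lp (fun _ : ℤ => EuclideanSpace ℂ (Fin m)) 2 →L[ℂ]
    lp (fun _ : ℤ => EuclideanSpace ℂ (Fin m)) 2}

theorem norm_sq_sub_smul_eq_tsum
    (hJ : ∀ (y : lp (fun _ : ℤ => EuclideanSpace ℂ (Fin m)) 2) (n : ℤ),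
      (J y) n = jacobiExpr a b (fun n => y n) n) (z : ℂ)
    (y : lp (fun _ : ℤ => EuclideanSpace ℂ (Fin m)) 2) :
    ‖J y - z • y‖ ^ 2 =
      ∑' n, ∑ i, ‖(jacobiExpr a b (fun n => y n) - z • fun n => (y n).ofLp) n i‖ ^ 2 := by
  rw [norm_sq_lp_euclidean]
  refine tsum_congr fun n => Finset.sum_congr rfl fun i _ => ?_
  rw [lp.coeFn_sub, lp.coeFn_smul]
  simp [hJ]

theorem isSelfAdjoint_of_jacobiExpr (hb : ∀ n : ℤ, (b n).IsHermitian)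
    (hJ : ∀ (y : lp (fun _ : ℤ => EuclideanSpace ℂ (Fin m)) 2) (n : ℤ),
      (J y) n = jacobiExpr a b (fun n => y n) n) : IsSelfAdjoint J := by
  rw [ContinuousLinearMap.isSelfAdjoint_iff_isSymmetric]
  intro y w
  simp only [ContinuousLinearMap.coe_coe]
  refine lp_two_induction_finite_support (P := fun y => inner ℂ (J y) w = inner ℂ y (J w))
    (isClosed_eq (by fun_prop) (by fun_prop)) (fun y hy => ?_) y
  have hs : ∀ (k : ℤ) (f : ℤ → ℂ), (∀ n, y (n + k) = 0 → f n = 0) → Summable f := by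
    intro k f hf
    refine summable_of_hasFiniteSupport ((hy.preimage (f := fun n => n + k) (by simp)).subset ?_)
    exact fun n hn h => hn (hf n h)
  have hs1 : Summable fun n => (w n).ofLp ⬝ᵥ star (a n *ᵥ (y (n + 1)).ofLp) :=
    hs 1 _ fun n h => by simp [h]
  have hs2 : Summable fun n => (w n).ofLp ⬝ᵥ star (b n *ᵥ (y n).ofLp) :=
    hs 0 _ fun n h => by rw [add_zero] at h; simp [h]
  have hs3 : Summable fun n => (w n).ofLp ⬝ᵥ star ((a (n - 1))ᴴ *ᵥ (y (n - 1)).ofLp) :=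
    hs (-1) _ fun n h => by rw [← sub_eq_add_neg] at h; simp [h]
  have ht1 : Summable fun n => (a n *ᵥ (w (n + 1)).ofLp) ⬝ᵥ star (y n).ofLp :=
    hs 0 _ fun n h => by rw [add_zero] at h; simp [h]
  have ht2 : Summable fun n => (b n *ᵥ (w n).ofLp) ⬝ᵥ star (y n).ofLp :=
    hs 0 _ fun n h => by rw [add_zero] at h; simp [h]
  have ht3 : Summable fun n => ((a (n - 1))ᴴ *ᵥ (w (n - 1)).ofLp) ⬝ᵥ star (y n).ofLp :=
    hs 0 _ fun n h => by rw [add_zero] at h; simp [h]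
  have hadj : ∀ (A : Matrix (Fin m) (Fin m) ℂ) (u v : Fin m → ℂ),
      u ⬝ᵥ star (A *ᵥ v) = (Aᴴ *ᵥ u) ⬝ᵥ star v := by
    intro A u v
    rw [Matrix.star_mulVec, dotProduct_comm, ← Matrix.dotProduct_mulVec, dotProduct_comm]
  simp only [lp.inner_eq_tsum, EuclideanSpace.inner_eq_star_dotProduct, hJ, jacobiExpr, star_add,
    dotProduct_add, add_dotProduct]
  rw [(hs1.add hs2).tsum_add hs3, hs1.tsum_add hs2, (ht1.add ht2).tsum_add ht3, ht1.tsum_add ht2]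
  have e1 : ∑' n, (w n).ofLp ⬝ᵥ star (a n *ᵥ (y (n + 1)).ofLp) =
      ∑' n, ((a (n - 1))ᴴ *ᵥ (w (n - 1)).ofLp) ⬝ᵥ star (y n).ofLp := by
    rw [← (Equiv.subRight (1 : ℤ)).tsum_eq]
    exact tsum_congr fun n => by simp [hadj]
  have e3 : ∑' n, (w n).ofLp ⬝ᵥ star ((a (n - 1))ᴴ *ᵥ (y (n - 1)).ofLp) =
      ∑' n, (a n *ᵥ (w (n + 1)).ofLp) ⬝ᵥ star (y n).ofLp := by
    rw [← (Equiv.addRight (1 : ℤ)).tsum_eq]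
    exact tsum_congr fun n => by simp [hadj]
  have e2 : ∑' n, (w n).ofLp ⬝ᵥ star (b n *ᵥ (y n).ofLp) =
      ∑' n, (b n *ᵥ (w n).ofLp) ⬝ᵥ star (y n).ofLp :=
    tsum_congr fun n => by rw [hadj, (hb n).eq]
  rw [e1, e2, e3]
  ring

/-- A bounded self-adjoint operator that is bounded below is invertible. -/
theorem IsSelfAdjoint.isUnit_of_bounded_below {H : Type*} [NormedAddCommGroup H]
    [InnerProductSpace ℂ H] [CompleteSpace H] {T : H →L[ℂ] H} (hT : IsSelfAdjoint T) {C : ℝ}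
    (hC : ∀ y, ‖y‖ ^ 2 ≤ C * ‖T y‖ ^ 2) : IsUnit T := by
  have hanti : AntilipschitzWith (Real.toNNReal (√|C|)) T := by
    refine AddMonoidHomClass.antilipschitz_of_bound T fun y => ?_
    rw [Real.coe_toNNReal _ (Real.sqrt_nonneg _)]
    refine (sq_le_sq₀ (norm_nonneg _) (by positivity)).mp ?_
    rw [mul_pow, Real.sq_sqrt (abs_nonneg C)]
    exact (hC y).trans (mul_le_mul_of_nonneg_right (le_abs_self C) (sq_nonneg _))
  rw [ContinuousLinearMap.isUnit_iff_bijective,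
    ContinuousLinearMap.bijective_iff_dense_range_and_antilipschitz]
  refine ⟨?_, _, hanti⟩
  rw [Submodule.topologicalClosure_eq_top_iff, ContinuousLinearMap.orthogonal_range, hT.adjoint_eq,
    LinearMap.ker_eq_bot]
  exact hanti.injective

theorem IsUnit.exists_norm_le_mul_norm_apply {H : Type*} [NormedAddCommGroup H]
    [NormedSpace ℂ H] {T : H →L[ℂ] H} (hT : IsUnit T) : ∃ C, ∀ y, ‖y‖ ≤ C * ‖T y‖ := by
  obtain ⟨U, rfl⟩ := hT
  refine ⟨‖(↑U⁻¹ : H →L[ℂ] H)‖, fun y => ?_⟩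
  calc ‖y‖ = ‖(↑U⁻¹ : H →L[ℂ] H) ((U : H →L[ℂ] H) y)‖ := by
        rw [← mul_apply_eq_comp, Units.inv_mul, one_apply_eq_self]
    _ ≤ _ := (↑U⁻¹ : H →L[ℂ] H).le_opNorm _

theorem jacobiExpr_smul_sub {u : ℤ → Fin m → ℂ} {z : ℂ} (hu : jacobiExpr a b u = z • u)
    (χ : ℤ → ℂ) (n : ℤ) :
    jacobiExpr a b (fun n => χ n • u n) n - z • χ n • u n =
      (χ (n + 1) - χ n) • (a n *ᵥ u (n + 1)) +
        (χ (n - 1) - χ n) • ((a (n - 1))ᴴ *ᵥ u (n - 1)) := by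
  have h : z • u n = jacobiExpr a b u n := by rw [hu]; rfl
  rw [smul_comm, h]
  simp only [jacobiExpr, Matrix.mulVec_smul]
  module

/-- A Bloch solution of `J u = z u` gives rise to a Weyl sequence for `z`. -/
theorem mem_spectrum_of_bloch_solution {p : ℕ} (hp : 0 < p)
    (hJ : ∀ (y : lp (fun _ : ℤ => EuclideanSpace ℂ (Fin m)) 2) (n : ℤ),
      (J y) n = jacobiExpr a b (fun n => y n) n)
    (hper : ∀ n : ℤ, a (n + p) = a n ∧ b (n + p) = b n) {c z : ℂ} (hc : ‖c‖ = 1)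
    {u : ℤ → Fin m → ℂ} (hu : ∀ n, u (n + p) = c • u n) (hz : jacobiExpr a b u = z • u)
    {n₀ : ℤ} (hn₀ : u n₀ ≠ 0) : z ∈ spectrum ℂ J := by
  by_contra hspec
  obtain ⟨C, hC⟩ := (spectrum.notMem_iff.mp hspec).exists_norm_le_mul_norm_apply
  set f : ℤ → EuclideanSpace ℂ (Fin m) := fun n => WithLp.toLp 2 (u n)
  have hf : Function.Periodic (fun n => ‖f n‖ ^ 2) p := fun n => by
    simp [f, hu, norm_smul, hc]
  set G : ℤ → ℝ := fun n =>
    ∑ i, (‖(a n *ᵥ u (n + 1)) i‖ + ‖((a (n - 1))ᴴ *ᵥ u (n - 1)) i‖) ^ 2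
  have hG0 : ∀ n, 0 ≤ G n := fun n => Finset.sum_nonneg fun i _ => by positivity
  have hG : Function.Periodic G p := fun n => by
    have h1 : (n + p - 1 : ℤ) = n - 1 + p := by ring
    simp only [G, h1, (hper _).1, add_right_comm n (p : ℤ) 1, hu, Matrix.mulVec_smul,
      Pi.smul_apply, smul_eq_mul, norm_mul, hc, one_mul]
  have hbound : ∀ N : ℕ, N * ‖f n₀‖ ^ 2 ≤ C ^ 2 * (4 * (G (n₀ - 1) + G n₀)) := by
    intro N
    set s := Finset.Ico n₀ (n₀ + N * p)
    set y : lp (fun _ : ℤ => EuclideanSpace ℂ (Fin m)) 2 := ∑ n ∈ s, lp.single 2 n (f n)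
    set χ : ℤ → ℂ := fun n => if n ∈ s then 1 else 0
    have hy : ∀ n, (y n).ofLp = χ n • u n := by
      intro n
      simp only [y, χ, f, lp.coeFn_sum, Finset.sum_apply, lp.single_apply, Pi.single_apply]
      rw [Finset.sum_ite_eq]
      split_ifs <;> simp
    have hlow : N * ‖f n₀‖ ^ 2 ≤ ‖y‖ ^ 2 := by
      have h1 : ‖y‖ ^ 2 = ∑ n ∈ s, ‖f n‖ ^ 2 := by
        have := lp.norm_sum_single (p := 2) (by norm_num) f s
        simpa using this
      have hinj : Set.InjOn (fun l : ℕ => n₀ + (l : ℤ) * p) (Finset.range N) := by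
        intro l _ l' _ h
        simpa [hp.ne'] using h
      have hsub : (Finset.range N).image (fun l : ℕ => n₀ + (l : ℤ) * p) ⊆ s := by
        intro n hn
        obtain ⟨l, hl, rfl⟩ := Finset.mem_image.mp hn
        have : l < N := Finset.mem_range.mp hl
        have h2 : (l : ℤ) * p < N * p := by gcongr
        have h3 : (0 : ℤ) ≤ l * p := by positivity
        simp only [s, Finset.mem_Ico]
        omega
      rw [h1]
      refine le_trans (le_of_eq ?_) (Finset.sum_le_sum_of_subset_of_nonneg hsub
        fun n _ _ => by positivity)
      rw [Finset.sum_image hinj]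
      have : ∀ l : ℕ, ‖f (n₀ + (l : ℤ) * p)‖ ^ 2 = ‖f n₀‖ ^ 2 := fun l => hf.int_mul l n₀
      simp [this]
    have hd : ∀ n i, ‖(jacobiExpr a b (fun n => y n) - z • fun n => (y n).ofLp) n i‖ ≤
        ‖χ (n + 1) - χ n‖ * ‖(a n *ᵥ u (n + 1)) i‖ +
          ‖χ (n - 1) - χ n‖ * ‖((a (n - 1))ᴴ *ᵥ u (n - 1)) i‖ := by
      intro n i
      have h := congrFun (jacobiExpr_smul_sub hz χ n) i
      simp only [hy, Pi.sub_apply, Pi.smul_apply, Pi.add_apply, smul_eq_mul] at h ⊢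
      rw [h, ← norm_mul, ← norm_mul]
      exact norm_add_le _ _
    have hχ : ∀ k l, ‖χ k - χ l‖ ≤ 1 := by
      intro k l
      simp only [χ]
      split_ifs <;> simp
    set T : Finset ℤ := {n₀ - 1, n₀, n₀ - 1 + N * p, n₀ + N * p}
    have hT : ∀ n ∉ T, χ (n + 1) = χ n ∧ χ (n - 1) = χ n := by
      intro n hn
      simp only [T, Finset.mem_insert, Finset.mem_singleton, not_or] at hn
      simp only [χ, s, Finset.mem_Ico]
      generalize (N : ℤ) * p = L at *
      constructor <;> congr 1 <;> simp only [eq_iff_iff] <;> omega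
    have hup : ‖J y - z • y‖ ^ 2 ≤ 4 * (G (n₀ - 1) + G n₀) := by
      rw [norm_sq_sub_smul_eq_tsum hJ, tsum_eq_sum (s := T)]
      · have hle : ∀ n ∈ T, ∑ i, ‖(jacobiExpr a b (fun n => y n) -
            z • fun n => (y n).ofLp) n i‖ ^ 2 ≤ G (n₀ - 1) + G n₀ := by
          intro n hn
          have h1 : ∑ i, ‖(jacobiExpr a b (fun n => y n) -
              z • fun n => (y n).ofLp) n i‖ ^ 2 ≤ G n := by
            refine Finset.sum_le_sum fun i _ => pow_le_pow_left₀ (norm_nonneg _) ?_ 2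
            refine (hd n i).trans (add_le_add ?_ ?_) <;>
              exact mul_le_of_le_one_left (norm_nonneg _) (hχ _ _)
          refine h1.trans ?_
          have g1 : G (n₀ - 1 + N * p) = G (n₀ - 1) := hG.int_mul N _
          have g2 : G (n₀ + N * p) = G n₀ := hG.int_mul N _
          simp only [T, Finset.mem_insert, Finset.mem_singleton] at hn
          rcases hn with h | h | h | h <;> rw [h] <;> linarith [hG0 (n₀ - 1), hG0 n₀]
        refine (Finset.sum_le_card_nsmul T _ _ hle).trans ?_
        rw [nsmul_eq_mul]
        have hcard : (T.card : ℝ) ≤ 4 := by exact_mod_cast Finset.card_le_four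
        exact mul_le_mul_of_nonneg_right hcard (add_nonneg (hG0 _) (hG0 _))
      · intro n hn
        refine Finset.sum_eq_zero fun i _ => ?_
        have := hd n i
        rw [(hT n hn).1, (hT n hn).2] at this
        simp only [sub_self, norm_zero, zero_mul, add_zero] at this
        rw [le_antisymm this (norm_nonneg _)]
        simp
    have hCy := pow_le_pow_left₀ (norm_nonneg _) (hC y) 2
    rw [mul_pow] at hCy
    have hnorm : ‖(algebraMap ℂ _ z - J) y‖ = ‖J y - z • y‖ := by
      rw [← norm_neg]
      simp [Algebra.algebraMap_eq_smul_one]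
    rw [hnorm] at hCy
    exact hlow.trans (hCy.trans (mul_le_mul_of_nonneg_left hup (sq_nonneg C)))
  have hpos : 0 < ‖f n₀‖ ^ 2 := by
    have : f n₀ ≠ 0 := fun h => hn₀ (by simpa [f] using h)
    positivity
  obtain ⟨N, hN⟩ := exists_nat_gt (C ^ 2 * (4 * (G (n₀ - 1) + G n₀)) / ‖f n₀‖ ^ 2)
  rw [div_lt_iff₀ hpos] at hN
  exact absurd (hbound N) (not_le.mpr hN)

end JacobiOperator

/-- Every vector on one period cell extends to a Bloch sequence. -/
theorem exists_bloch_extension {m p : ℕ} (hp : 0 < p) (x : ℝ) (v : Fin p × Fin m → ℂ) :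
    ∃ u : ℤ → Fin m → ℂ, (∀ n, u (n + p) = Complex.exp (x * Complex.I) • u n) ∧
      ∀ (q : Fin p) i, u ((q : ℕ) + 1) i = v (q, i) := by
  have : NeZero p := ⟨hp.ne'⟩
  set e := Int.divModEquiv p
  refine ⟨fun n i => Complex.exp ((e (n - 1)).1 * (x * Complex.I)) * v ((e (n - 1)).2, i),
    fun n => ?_, fun q i => ?_⟩
  · have h : e (n + p - 1) = ((e (n - 1)).1 + 1, (e (n - 1)).2) := by
      have h1 : (e (n - 1)).1 * p + ((e (n - 1)).2 : ℕ) = n - 1 := e.symm_apply_apply (n - 1)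
      rw [← Equiv.eq_symm_apply]
      simp only [e, Int.divModEquiv_symm_apply] at h1 ⊢
      linear_combination -h1
    ext i
    simp only [h, Pi.smul_apply, smul_eq_mul, ← mul_assoc, ← Complex.exp_add]
    push_cast
    ring_nf
  · have h : e ((q : ℕ) + 1 - 1) = (0, q) := by
      rw [← Equiv.eq_symm_apply]
      simp [e, Int.divModEquiv]
    simp only [h]
    simp

/-- **Floquet–Bloch decomposition of the spectrum**: for a `p`-periodic matrix-valued Jacobi
operator `J` on `ℓ²(ℤ, ℂ^m)`, the spectrum of `J` is the union over `x ∈ [0, 2π]` of the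
spectra of the Floquet matrices `K(x)`. -/
theorem spectrum_periodic_jacobi_eq_iUnion_spectrum_floquet (m p : ℕ) (hm : 0 < m) (hp : 3 ≤ p)
    (a b : ℤ → Matrix (Fin m) (Fin m) ℂ)
    (hper : ∀ n : ℤ, a (n + p) = a n ∧ b (n + p) = b n)
    (hb : ∀ n : ℤ, (b n).IsHermitian)
    (J : lp (fun _ : ℤ => EuclideanSpace ℂ (Fin m)) 2 →L[ℂ]
         lp (fun _ : ℤ => EuclideanSpace ℂ (Fin m)) 2)
    (hJ : ∀ (y : lp (fun _ : ℤ => EuclideanSpace ℂ (Fin m)) 2) (n : ℤ),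
      (J y) n = (a n).mulVec (y (n + 1)) + (b n).mulVec (y n)
        + ((a (n - 1))ᴴ).mulVec (y (n - 1))) :
    spectrum ℂ J = ⋃ x ∈ Set.Icc (0:ℝ) (2 * Real.pi), spectrum ℂ (FloquetK m p a b x) := by
  have hp0 : 0 < p := by omega
  replace hJ : ∀ (y : lp (fun _ : ℤ => EuclideanSpace ℂ (Fin m)) 2) (n : ℤ),
      (J y) n = jacobiExpr a b (fun n => y n) n := hJ
  refine Set.Subset.antisymm (fun z hz => ?_) (Set.iUnion₂_subset fun x _ z hz => ?_)
  · by_contra hzK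
    simp only [Set.mem_iUnion, not_exists] at hzK
    obtain ⟨C, hC⟩ := exists_lower_bound_of_finite_support hp hper hzK
    have hsa := isSelfAdjoint_of_jacobiExpr hb hJ
    have hreal := hsa.mem_spectrum_eq_re hz
    refine hz ?_
    have hsa' : IsSelfAdjoint (algebraMap ℂ (lp (fun _ : ℤ => EuclideanSpace ℂ (Fin m)) 2 →L[ℂ]
         lp (fun _ : ℤ => EuclideanSpace ℂ (Fin m)) 2) z - J) := by
      refine IsSelfAdjoint.sub (IsSelfAdjoint.algebraMap _ ?_) hsa
      rw [hreal]
      exact Complex.conj_ofReal _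
    refine hsa'.isUnit_of_bounded_below (C := C) fun y => ?_
    have hnorm : ∀ y, ‖(algebraMap ℂ (lp (fun _ : ℤ => EuclideanSpace ℂ (Fin m)) 2 →L[ℂ]
         lp (fun _ : ℤ => EuclideanSpace ℂ (Fin m)) 2) z - J) y‖ = ‖J y - z • y‖ := by
      intro y
      rw [← norm_neg]
      simp [Algebra.algebraMap_eq_smul_one]
    rw [hnorm]
    refine lp_two_induction_finite_support (P := fun y => ‖y‖ ^ 2 ≤ C * ‖J y - z • y‖ ^ 2)
      (isClosed_le (by fun_prop) (by fun_prop)) (fun y hy => ?_) y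
    rw [norm_sq_lp_euclidean, norm_sq_sub_smul_eq_tsum hJ]
    exact hC _ (hy.subset fun n hn h => hn (by simp [h]))
  · rw [← Matrix.spectrum_toLin', ← Module.End.hasEigenvalue_iff_mem_spectrum] at hz
    obtain ⟨v, hv⟩ := hz.exists_hasEigenvector
    have hKv : FloquetK m p a b x *ᵥ v = z • v := by simpa using hv.apply_eq_smul
    obtain ⟨u, hu, huv⟩ := exists_bloch_extension hp0 x v
    have huv' : (fun q : Fin p × Fin m => u ((q.1 : ℕ) + 1) q.2) = v := funext fun q => huv q.1 q.2
    have hjac : jacobiExpr a b u = z • u := by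
      have hd : Function.Periodic (fun n => jacobiExpr a b u n = z • u n) p := by
        intro n
        simp only [jacobiExpr_add_period hper hu, hu, smul_comm z]
        simp
      have : NeZero p := ⟨hp0.ne'⟩
      funext n
      obtain ⟨⟨k, q⟩, hkq⟩ := (Int.divModEquiv p).symm.surjective (n - 1)
      obtain rfl : n = (q : ℕ) + 1 + k * p := by
        rw [Int.divModEquiv_symm_apply] at hkq
        linear_combination -hkq
      refine (hd.int_mul k _).mpr (funext fun i => ?_)
      have hK := congrFun (floquetK_mulVec_of_bloch hp hper hu) (q, i)
      rw [huv', hKv] at hK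
      simpa [huv] using hK.symm
    obtain ⟨⟨q, i⟩, hq⟩ := Function.ne_iff.mp hv.2
    refine mem_spectrum_of_bloch_solution hp0 hJ hper (Complex.norm_exp_ofReal_mul_I x) hu hjac
      (n₀ := (q : ℕ) + 1) fun h => hq ?_
    rw [← huv, h]
    simp
end

section
/- Let J⁰ be the discrete Schrödinger (free Jacobi) operator on ℓ²(ℤ, ℂ) defined by (J⁰y)_n = y_{n+1} + y_{n-1}. Then J⁰ is a bounded self-adjoint operator and its spectrum is σ(J⁰) = [−2, 2]. -/
open ComplexOrder
open scoped ENNReal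

/-- A null sequence whose consecutive terms have constant ratio of modulus one vanishes. -/
lemma eq_zero_of_tendsto_of_succ_eq_mul {f : ℕ → ℂ} {z : ℂ} (hz : ‖z‖ = 1)
    (hf : Filter.Tendsto f Filter.atTop (nhds 0)) (h : ∀ k, f (k + 1) = z * f k) (k : ℕ) :
    f k = 0 := by
  have hnorm : ∀ m, ‖f m‖ = ‖f 0‖ := by
    intro m
    induction m with
    | zero => rfl
    | succ m ih => rw [h, norm_mul, hz, one_mul, ih]
  have hlim := hf.norm
  simp only [hnorm, norm_zero] at hlim
  have h0 : ‖f 0‖ = 0 := tendsto_nhds_unique tendsto_const_nhds hlim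
  rw [← norm_eq_zero, hnorm, h0]

/-- A null sequence satisfying `f (k + 2) + f k = (z + w) * f (k + 1)` with `z * w = 1` and
`z`, `w` of modulus one vanishes. -/
lemma eq_zero_of_tendsto_of_recurrence {f : ℕ → ℂ} {z w : ℂ} (hz : ‖z‖ = 1) (hw : ‖w‖ = 1)
    (hzw : z * w = 1) (hf : Filter.Tendsto f Filter.atTop (nhds 0))
    (h : ∀ k, f (k + 2) + f k = (z + w) * f (k + 1)) (k : ℕ) : f k = 0 := by
  have hlim : Filter.Tendsto (fun k => f (k + 1) - z * f k) Filter.atTop (nhds 0) := by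
    simpa using (hf.comp (Filter.tendsto_add_atTop_nat 1)).sub (hf.const_mul z)
  have hdiff := eq_zero_of_tendsto_of_succ_eq_mul hw hlim fun k => by
    linear_combination h k + f k * hzw
  exact eq_zero_of_tendsto_of_succ_eq_mul hz hf (fun k => sub_eq_zero.mp (hdiff k)) k

lemma Complex.exists_norm_eq_one_add_eq {r : ℝ} (hr : r ∈ Set.Icc (-2 : ℝ) 2) :
    ∃ z w : ℂ, ‖z‖ = 1 ∧ ‖w‖ = 1 ∧ z * w = 1 ∧ z + w = r := by
  have hcos : Real.cos (Real.arccos (r / 2)) = r / 2 :=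
    Real.cos_arccos (by linarith [hr.1]) (by linarith [hr.2])
  set θ := Real.arccos (r / 2)
  refine ⟨Complex.exp (θ * Complex.I), Complex.exp (((-θ : ℝ) : ℂ) * Complex.I),
    Complex.norm_exp_ofReal_mul_I _, Complex.norm_exp_ofReal_mul_I _, ?_, ?_⟩
  · rw [← Complex.exp_add]
    simp
  · have h2 : r = 2 * Real.cos θ := by rw [hcos]; ring
    rw [h2]
    push_cast
    rw [Complex.two_cos]

namespace lp

lemma tendsto_cofinite_zero {ι : Type*} (y : lp (fun _ : ι => ℂ) 2) :
    Filter.Tendsto (fun n => y n) Filter.cofinite (nhds 0) := by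
  have hs : Summable fun n => ‖y n‖ ^ (2 : ℝ) := by
    simpa using (lp.memℓp y).summable (by simp)
  have h := (hs.tendsto_cofinite_zero).rpow_const (p := (1 / 2 : ℝ)) (Or.inr (by norm_num))
  rw [tendsto_zero_iff_norm_tendsto_zero]
  convert h using 2
  · rw [← Real.rpow_mul (norm_nonneg _)]
    norm_num
  · norm_num

/-- Reindexing of a square-summable family along a permutation of the indices. -/
noncomputable def reindex {ι : Type*} (e : ι ≃ ι) (y : lp (fun _ : ι => ℂ) 2) :
    lp (fun _ : ι => ℂ) 2 :=
  ⟨fun n => y (e n), memℓp_gen ((e.summable_iff).mpr ((lp.memℓp y).summable (by simp)))⟩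

lemma reindex_apply {ι : Type*} (e : ι ≃ ι) (y : lp (fun _ : ι => ℂ) 2) (n : ι) :
    reindex e y n = y (e n) := rfl

lemma inner_reindex_left {ι : Type*} (e : ι ≃ ι) (x y : lp (fun _ : ι => ℂ) 2) :
    inner ℂ (reindex e x) y = inner ℂ x (reindex e.symm y) := by
  rw [lp.inner_eq_tsum, lp.inner_eq_tsum, ← e.symm.tsum_eq]
  simp [reindex_apply]

lemma norm_reindex {ι : Type*} (e : ι ≃ ι) (y : lp (fun _ : ι => ℂ) 2) :
    ‖reindex e y‖ = ‖y‖ := by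
  have h : reindex e.symm (reindex e y) = y := by
    ext n
    simp [reindex_apply]
  rw [@norm_eq_sqrt_re_inner ℂ, inner_reindex_left, h, ← @norm_eq_sqrt_re_inner ℂ]

end lp

/-- The discrete Schrödinger (free Jacobi) operator `J⁰` on `ℓ²(ℤ, ℂ)`, acting by
`(J⁰y)_n = y_{n+1} + y_{n-1}`, is a bounded self-adjoint operator with spectrum `[−2, 2]`. -/
theorem spectrum_discrete_schrodinger
    (J0 : lp (fun _ : ℤ => ℂ) 2 →L[ℂ] lp (fun _ : ℤ => ℂ) 2)
    (hJ0 : ∀ (y : lp (fun _ : ℤ => ℂ) 2) (n : ℤ), (J0 y) n = y (n + 1) + y (n - 1)) :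
    IsSelfAdjoint J0 ∧ spectrum ℂ J0 = (fun r : ℝ => (r : ℂ)) '' Set.Icc (-2 : ℝ) 2 := by
  let e : ℤ ≃ ℤ := Equiv.addRight 1
  have hJ : ∀ y, J0 y = lp.reindex e y + lp.reindex e.symm y := by
    intro y
    ext n
    rw [hJ0]
    rfl
  have hsa : IsSelfAdjoint J0 := by
    rw [ContinuousLinearMap.isSelfAdjoint_iff_isSymmetric]
    intro x y
    simp only [ContinuousLinearMap.coe_coe, hJ, inner_add_left, inner_add_right,
      lp.inner_reindex_left, Equiv.symm_symm]
    exact add_comm _ _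
  have hnorm : ‖J0‖ ≤ 2 := by
    refine J0.opNorm_le_bound (by norm_num) fun y => ?_
    rw [hJ]
    refine (norm_add_le _ _).trans_eq ?_
    rw [lp.norm_reindex, lp.norm_reindex]
    ring
  refine ⟨hsa, Set.Subset.antisymm (fun z hz => ?_) ?_⟩
  · have hle : |z.re| ≤ 2 :=
      (Complex.abs_re_le_norm z).trans <| (spectrum.norm_le_norm_mul_of_mem hz).trans <|
        (mul_le_of_le_one_right (norm_nonneg _) ContinuousLinearMap.norm_id_le).trans hnorm
    exact ⟨z.re, abs_le.mp hle, (hsa.mem_spectrum_eq_re hz).symm⟩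
  · rintro _ ⟨r, hr, rfl⟩
    obtain ⟨z, w, hz, hw, hzw, hsum⟩ := Complex.exists_norm_eq_one_add_eq hr
    rw [spectrum.mem_iff]
    intro hunit
    obtain ⟨y, hy⟩ :=
      (ContinuousLinearMap.isUnit_iff_bijective.mp hunit).surjective (lp.single 2 (0 : ℤ) (1 : ℂ))
    have hyn : ∀ n : ℤ, (r : ℂ) * y n - (y (n + 1) + y (n - 1)) =
        (lp.single 2 (0 : ℤ) (1 : ℂ) : lp (fun _ : ℤ => ℂ) 2) n := by
      intro n
      rw [← hy, ← hJ0]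
      rfl
    have hrec : ∀ n : ℤ, n ≠ 0 → y (n + 1) + y (n - 1) = (z + w) * y n := by
      intro n hn
      have h := hyn n
      rw [lp.single_apply_ne _ _ _ hn] at h
      rw [hsum]
      linear_combination -h
    have hlim := lp.tendsto_cofinite_zero y
    have hpos := eq_zero_of_tendsto_of_recurrence (f := fun k : ℕ => y (k : ℤ)) hz hw hzw
      (by
        rw [← Nat.cofinite_eq_atTop]
        exact hlim.comp Nat.cast_injective.tendsto_cofinite)
      fun k => by
        convert hrec (k + 1) (by omega) using 3 <;> push_cast <;> ring_nf
    have hneg := eq_zero_of_tendsto_of_recurrence (f := fun k : ℕ => y (-(k : ℤ))) hz hw hzw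
      (by
        rw [← Nat.cofinite_eq_atTop]
        exact hlim.comp (neg_injective.comp Nat.cast_injective).tendsto_cofinite)
      fun k => by
        rw [add_comm]
        convert hrec (-(k + 1)) (by omega) using 3 <;> push_cast <;> ring_nf
    have h := hyn 0
    have h0 : y 0 = 0 := by simpa using hpos 0
    have h1 : y 1 = 0 := by simpa using hpos 1
    have h2 : y (-1) = 0 := by simpa using hneg 1
    rw [lp.single_apply_self] at h
    simp [h0, h1, h2] at h
end
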